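/- arXiv:math/0112139 — 12 statements merged into one kernel-verified Lean document; each statement's English description precedes it below -/
import Mathlib

section
/- Under the stated hypotheses, the contracted coordinates satisfy the h-deformed superplane relation xθ = q·θx + h2·x². -/
/-- Under the contraction of the (p,q)-superplane, the new coordinates satisfy
    the h-deformed superplane relation `xθ = q·θx + h₂·x²`. -/
theorem h_superplane_relation_xtheta
    {K : Type*} [Field K] {R : Type*} [Ring R] [Algebra K R]
    (p q : K) (hp : p ≠ 1) (hq : q ≠ 1)
    (x' θ' h1 h2 : R)
    -- (p,q)-superplane relations
    (hplane : x' * θ' = q • (θ' * x'))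
    (hθ'sq : θ' * θ' = 0)
    -- h1, h2 are odd parameters
    (hh1sq : h1 * h1 = 0) (hh2sq : h2 * h2 = 0)
    (hh12 : h1 * h2 = -(h2 * h1))
    -- h1, h2 commute with x' and anticommute with θ'
    (hh1x : h1 * x' = x' * h1) (hh2x : h2 * x' = x' * h2)
    (hh1θ : h1 * θ' = -(θ' * h1)) (hh2θ : h2 * θ' = -(θ' * h2))
    -- contracted coordinates
    (x θ : R)
    (hx : x = x' - (p - 1)⁻¹ • (h1 * θ'))
    (hθ : θ = -((q - 1)⁻¹ • (h2 * x')) +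
      (θ' - ((p - 1)⁻¹ * (q - 1)⁻¹) • (h1 * h2 * θ'))) :
    x * θ = q • (θ * x) + h2 * x ^ 2 := by
  have hb : (q - 1)⁻¹ * (q - 1) = 1 := inv_mul_cancel₀ (sub_ne_zero.mpr hq)
  generalize (q - 1)⁻¹ = b at *
  generalize (p - 1)⁻¹ = a at *
  -- rewriting rules moving the odd parameters to the left, in increasing order
  have xh1_assoc (r : R) : x' * (h1 * r) = h1 * (x' * r) := by
    rw [← mul_assoc, ← hh1x, mul_assoc]
  have xh2_assoc (r : R) : x' * (h2 * r) = h2 * (x' * r) := by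
    rw [← mul_assoc, ← hh2x, mul_assoc]
  have θh1_assoc (r : R) : θ' * (h1 * r) = -(h1 * (θ' * r)) := by
    rw [← mul_assoc, ← mul_assoc, hh1θ, neg_mul, neg_neg]
  have θh2_assoc (r : R) : θ' * (h2 * r) = -(h2 * (θ' * r)) := by
    rw [← mul_assoc, ← mul_assoc, hh2θ, neg_mul, neg_neg]
  have h21_assoc (r : R) : h2 * (h1 * r) = -(h1 * (h2 * r)) := by
    rw [← mul_assoc, ← mul_assoc, hh12, neg_mul, neg_neg]
  subst hx hθ
  simp only [pow_two, mul_add, add_mul, mul_sub, sub_mul, mul_neg, neg_mul, smul_mul_assoc,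
    mul_smul_comm, mul_assoc, hplane, hθ'sq, xh1_assoc, xh2_assoc, θh1_assoc, θh2_assoc,
    h21_assoc, smul_neg, smul_zero, mul_zero, neg_zero, neg_neg]
  match_scalars
  · linear_combination hb
  · linear_combination a * (q + 1) * hb
  · ring
end

section
/- Under the stated hypotheses, the contracted coordinates satisfy the h-deformed superplane relation θ² = −h2·θx. -/
/-- Under the contraction of the (p,q)-superplane, the new coordinates satisfy
    the h-deformed superplane relation `θ² = −h₂·θx`. -/
theorem h_superplane_relation_thetasq
    {K : Type*} [Field K] {R : Type*} [Ring R] [Algebra K R]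
    (p q : K) (hp : p ≠ 1) (hq : q ≠ 1)
    (x' θ' h1 h2 : R)
    -- (p,q)-superplane relations
    (hplane : x' * θ' = q • (θ' * x'))
    (hθ'sq : θ' * θ' = 0)
    -- h1, h2 are odd parameters
    (hh1sq : h1 * h1 = 0) (hh2sq : h2 * h2 = 0)
    (hh12 : h1 * h2 = -(h2 * h1))
    -- h1, h2 commute with x' and anticommute with θ'
    (hh1x : h1 * x' = x' * h1) (hh2x : h2 * x' = x' * h2)
    (hh1θ : h1 * θ' = -(θ' * h1)) (hh2θ : h2 * θ' = -(θ' * h2))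
    -- contracted coordinates
    (x θ : R)
    (hx : x = x' - (p - 1)⁻¹ • (h1 * θ'))
    (hθ : θ = -((q - 1)⁻¹ • (h2 * x')) +
      (θ' - ((p - 1)⁻¹ * (q - 1)⁻¹) • (h1 * h2 * θ'))) :
    θ * θ = -(h2 * (θ * x)) := by
  have hq' : q - 1 ≠ 0 := sub_ne_zero.mpr hq
  have h2_mul_h2 (r : R) : h2 * (h2 * r) = 0 := by rw [← mul_assoc, hh2sq, zero_mul]
  have h2_mul_h1 (r : R) : h2 * (h1 * r) = -(h1 * (h2 * r)) := by
    simp only [← mul_assoc, hh12, neg_mul, neg_neg]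
  have x'_mul_h1 (r : R) : x' * (h1 * r) = h1 * (x' * r) := by
    simp only [← mul_assoc, hh1x]
  have x'_mul_h2 (r : R) : x' * (h2 * r) = h2 * (x' * r) := by
    simp only [← mul_assoc, hh2x]
  have θ'_mul_h1 (r : R) : θ' * (h1 * r) = -(h1 * (θ' * r)) := by
    simp only [← mul_assoc, hh1θ, neg_mul, neg_neg]
  have θ'_mul_h2 (r : R) : θ' * (h2 * r) = -(h2 * (θ' * r)) := by
    simp only [← mul_assoc, hh2θ, neg_mul, neg_neg]
  have θ_sq : θ * θ = -(h2 * (θ' * x')) := by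
    have expand : θ * θ =
        (q - 1)⁻¹ • (h2 * (θ' * x')) - ((q - 1)⁻¹ * q) • (h2 * (θ' * x')) := by
      simp only [hθ, mul_add, add_mul, mul_sub, sub_mul, mul_assoc, mul_neg, neg_mul,
        mul_smul_comm, smul_mul_assoc, x'_mul_h1, x'_mul_h2, θ'_mul_h1, θ'_mul_h2, h2_mul_h1,
        h2_mul_h2, hθ'sq, hplane, mul_zero, smul_zero, neg_zero]
      module
    rw [expand, ← sub_smul, show (q - 1)⁻¹ - (q - 1)⁻¹ * q = -1 by field_simp; ring,
      neg_one_smul]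
  have h2_mul_θ_mul_x : h2 * (θ * x) = h2 * (θ' * x') := by
    simp only [hx, hθ, mul_add, add_mul, mul_sub, sub_mul, mul_assoc, mul_neg, neg_mul,
      mul_smul_comm, smul_mul_assoc, θ'_mul_h1, h2_mul_h1,
      h2_mul_h2, hθ'sq, mul_zero, smul_zero, neg_zero]
    module
  rw [θ_sq, h2_mul_θ_mul_x]
end

section
/- Under the stated hypotheses, the contracted differentials satisfy dθ·dx = p·dx·dθ − h1·(dθ)². -/
/-- Under the contraction of the (p,q)-superplane differentials, the new
    differentials satisfy `dθ·dx = p·dx·dθ − h₁·(dθ)²`. -/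
theorem h_superplane_differentials_rel1
    {K : Type*} [Field K] {R : Type*} [Ring R] [Algebra K R]
    (p q : K) (hp0 : p ≠ 0) (hp : p ≠ 1) (hq : q ≠ 1)
    (dx' dθ' h1 h2 : R)
    -- primed differential relations
    (hrel : dx' * dθ' = p⁻¹ • (dθ' * dx'))
    (hdx'sq : dx' * dx' = 0)
    -- h1, h2 are odd parameters
    (hh1sq : h1 * h1 = 0) (hh2sq : h2 * h2 = 0)
    (hh12 : h1 * h2 = -(h2 * h1))
    -- h1, h2 anticommute with the odd dx' and commute with the even dθ'
    (hh1dx : h1 * dx' = -(dx' * h1)) (hh2dx : h2 * dx' = -(dx' * h2))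
    (hh1dθ : h1 * dθ' = dθ' * h1) (hh2dθ : h2 * dθ' = dθ' * h2)
    -- contracted differentials
    (dx dθ : R)
    (hdx : dx = dx' + (p - 1)⁻¹ • (h1 * dθ'))
    (hdθ : dθ = (q - 1)⁻¹ • (h2 * dx') +
      (dθ' - ((p - 1)⁻¹ * (q - 1)⁻¹) • (h1 * h2 * dθ'))) :
    dθ * dx = p • (dx * dθ) - h1 * (dθ * dθ) := by
  have hp1 : p - 1 ≠ 0 := sub_ne_zero.mpr hp
  have hq1 : q - 1 ≠ 0 := sub_ne_zero.mpr hq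
  -- Rewrite rules moving every monomial into a fixed order: parameters first, then odd, then even.
  have tx : dθ' * dx' = p • (dx' * dθ') := by rw [hrel, smul_inv_smul₀ hp0]
  have xh1 : dx' * h1 = -(h1 * dx') := by rw [hh1dx, neg_neg]
  have xh2 : dx' * h2 = -(h2 * dx') := by rw [hh2dx, neg_neg]
  have h21 : h2 * h1 = -(h1 * h2) := by rw [hh12, neg_neg]
  have xh1_assoc (r : R) : dx' * (h1 * r) = -(h1 * (dx' * r)) := by
    rw [← mul_assoc, xh1, neg_mul, mul_assoc]
  have xh2_assoc (r : R) : dx' * (h2 * r) = -(h2 * (dx' * r)) := by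
    rw [← mul_assoc, xh2, neg_mul, mul_assoc]
  have h21_assoc (r : R) : h2 * (h1 * r) = -(h1 * (h2 * r)) := by
    rw [← mul_assoc, h21, neg_mul, mul_assoc]
  have th1_assoc (r : R) : dθ' * (h1 * r) = h1 * (dθ' * r) := by
    rw [← mul_assoc, ← hh1dθ, mul_assoc]
  have th2_assoc (r : R) : dθ' * (h2 * r) = h2 * (dθ' * r) := by
    rw [← mul_assoc, ← hh2dθ, mul_assoc]
  have h11_assoc (r : R) : h1 * (h1 * r) = 0 := by rw [← mul_assoc, hh1sq, zero_mul]
  have h22_assoc (r : R) : h2 * (h2 * r) = 0 := by rw [← mul_assoc, hh2sq, zero_mul]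
  subst hdx hdθ
  simp only [mul_add, add_mul, mul_sub, sub_mul, mul_assoc, smul_mul_assoc, mul_smul_comm,
    mul_neg, tx, xh1_assoc, xh2_assoc, h21_assoc, th1_assoc, th2_assoc,
    h11_assoc, h22_assoc, hdx'sq, smul_zero, mul_zero, neg_zero]
  match_scalars <;> field_simp <;> ring
end

section
/- Under the stated hypotheses, the contracted differentials satisfy (dx)² = h1·dx·dθ. -/
/-- Under the contraction of the (p,q)-superplane differentials, the new
    differentials satisfy `(dx)² = h₁·dx·dθ`. -/
theorem h_superplane_differentials_rel2
    {K : Type*} [Field K] {R : Type*} [Ring R] [Algebra K R]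
    (p q : K) (hp0 : p ≠ 0) (hp : p ≠ 1) (hq : q ≠ 1)
    (dx' dθ' h1 h2 : R)
    -- primed differential relations
    (hrel : dx' * dθ' = p⁻¹ • (dθ' * dx'))
    (hdx'sq : dx' * dx' = 0)
    -- h1, h2 are odd parameters
    (hh1sq : h1 * h1 = 0) (hh2sq : h2 * h2 = 0)
    (hh12 : h1 * h2 = -(h2 * h1))
    -- h1, h2 anticommute with the odd dx' and commute with the even dθ'
    (hh1dx : h1 * dx' = -(dx' * h1)) (hh2dx : h2 * dx' = -(dx' * h2))
    (hh1dθ : h1 * dθ' = dθ' * h1) (hh2dθ : h2 * dθ' = dθ' * h2)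
    -- contracted differentials
    (dx dθ : R)
    (hdx : dx = dx' + (p - 1)⁻¹ • (h1 * dθ'))
    (hdθ : dθ = (q - 1)⁻¹ • (h2 * dx') +
      (dθ' - ((p - 1)⁻¹ * (q - 1)⁻¹) • (h1 * h2 * dθ'))) :
    dx * dx = h1 * (dx * dθ) := by
  have hp1 : p - 1 ≠ 0 := sub_ne_zero.mpr hp
  have hswap : dθ' * dx' = p • (dx' * dθ') := by
    rw [hrel, smul_smul, mul_inv_cancel₀ hp0, one_smul]
  have hxh1 : dx' * h1 = -(h1 * dx') := by rw [hh1dx, neg_neg]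
  have hsq : dx * dx = h1 * (dx' * dθ') := by
    have hcross : dx' * (h1 * dθ') = -(h1 * (dx' * dθ')) := by
      rw [← mul_assoc, hxh1, neg_mul, mul_assoc]
    have hcross' : h1 * dθ' * dx' = p • (h1 * (dx' * dθ')) := by
      rw [mul_assoc, hswap, mul_smul_comm]
    have hnil : h1 * dθ' * (h1 * dθ') = 0 := by
      rw [hh1dθ, mul_assoc, ← hh1dθ, ← mul_assoc h1 h1, hh1sq, zero_mul, mul_zero]
    calc dx * dx = ((p - 1)⁻¹ * (p - 1)) • (h1 * (dx' * dθ')) := by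
          rw [hdx, add_mul, mul_add, mul_add, hdx'sq]
          simp only [smul_mul_assoc, mul_smul_comm, hcross, hcross', hnil]
          module
      _ = h1 * (dx' * dθ') := by rw [inv_mul_cancel₀ hp1, one_smul]
  have hh1dx_left : h1 * dx = h1 * dx' := by
    rw [hdx, mul_add, mul_smul_comm, ← mul_assoc, hh1sq, zero_mul, smul_zero, add_zero]
  have hxh2x : dx' * (h2 * dx') = 0 := by
    rw [hh2dx, mul_neg, ← mul_assoc, hdx'sq, zero_mul, neg_zero]
  have hh1xh1 : h1 * dx' * h1 = 0 := by
    rw [mul_assoc, hxh1, mul_neg, ← mul_assoc, hh1sq, zero_mul, neg_zero]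
  have hquad : h1 * dx' * (h1 * h2 * dθ') = 0 := by
    rw [mul_assoc h1 h2, ← mul_assoc, hh1xh1, zero_mul]
  rw [hsq, ← mul_assoc h1 dx, hh1dx_left, hdθ, mul_add, mul_sub, mul_smul_comm, mul_smul_comm,
    hquad, mul_assoc h1 dx' (h2 * dx'), hxh2x, mul_zero, smul_zero, smul_zero, zero_add, sub_zero,
    mul_assoc]
end

section
/- Under the stated hypotheses, the unprimed derivative satisfies ∂x·θ = p·θ∂x − p·h2·(x∂x + θ∂θ). -/
/-- ∂x·θ = p·θ∂x − p·h₂·(x∂x + θ∂θ). -/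
theorem h_superplane_Dx_theta
    {K : Type*} [Field K] {R : Type*} [Ring R] [Algebra K R]
    (p q : K) (hp : p ≠ 1) (hq : q ≠ 1)
    (x θ Dx Dθ h1 h2 : R)
    -- h1, h2 are odd parameters
    (hh1sq : h1 * h1 = 0) (hh2sq : h2 * h2 = 0)
    (hh12 : h1 * h2 = -(h2 * h1))
    -- h1, h2 commute with the even x, ∂x and anticommute with the odd θ, ∂θ
    (hh1x : h1 * x = x * h1) (hh2x : h2 * x = x * h2)
    (hh1Dx : h1 * Dx = Dx * h1) (hh2Dx : h2 * Dx = Dx * h2)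
    (hh1θ : h1 * θ = -(θ * h1)) (hh2θ : h2 * θ = -(θ * h2))
    (hh1Dθ : h1 * Dθ = -(Dθ * h1)) (hh2Dθ : h2 * Dθ = -(Dθ * h2))
    -- primed quantities
    (x' θ' Dx' Dθ' : R)
    (hx' : x' = x + ((p - 1)⁻¹ * (q - 1)⁻¹) • (h1 * h2 * x) + (p - 1)⁻¹ • (h1 * θ))
    (hθ' : θ' = θ + (q - 1)⁻¹ • (h2 * x))
    (hDx' : Dx' = Dx - (q - 1)⁻¹ • (h2 * Dθ))
    (hDθ' : Dθ' = (p - 1)⁻¹ • (h1 * Dx) +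
      (Dθ - ((p - 1)⁻¹ * (q - 1)⁻¹) • (h1 * h2 * Dθ)))
    -- (p,q)-deformed superplane calculus relations for the primed quantities
    (hplane : x' * θ' = q • (θ' * x'))
    (hθ'sq : θ' * θ' = 0)
    (hDx'x' : Dx' * x' = 1 + (p * q) • (x' * Dx') + (p * q - 1) • (θ' * Dθ'))
    (hDx'θ' : Dx' * θ' = p • (θ' * Dx'))
    (hDθ'x' : Dθ' * x' = q • (x' * Dθ'))
    (hDθ'θ' : Dθ' * θ' = 1 - θ' * Dθ')
    (hDD : Dθ' * Dx' = p • (Dx' * Dθ'))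
    (hDθ'sq : Dθ' * Dθ' = 0) :
    Dx * θ = p • (θ * Dx) - p • (h2 * (x * Dx + θ * Dθ)) := by
  have hb : (q - 1) * (q - 1)⁻¹ = 1 := mul_inv_cancel₀ (sub_ne_zero.mpr hq)
  generalize (p - 1)⁻¹ = a at *
  generalize (q - 1)⁻¹ = b at *
  -- rewriting rules that move the parameters to the left, `h2` before `h1`
  have left_assoc {u v w : R} (h : u * v = w) (z : R) : u * (v * z) = w * z := by
    rw [← mul_assoc, h]
  have hθh1 : θ * h1 = -(h1 * θ) := by rw [hh1θ, neg_neg]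
  have hθh2 : θ * h2 = -(h2 * θ) := by rw [hh2θ, neg_neg]
  have hDθh2 : Dθ * h2 = -(h2 * Dθ) := by rw [hh2Dθ, neg_neg]
  have h2_Dx_x := congrArg (h2 * ·) hDx'x'
  have h2_Dθ_θ := congrArg (h2 * ·) hDθ'θ'
  subst hx' hθ' hDx' hDθ'
  simp only [mul_add, add_mul, mul_sub, sub_mul, mul_assoc, smul_mul_assoc, mul_smul_comm,
    left_assoc hh2sq, left_assoc hh12, left_assoc hh2x.symm, left_assoc hh1Dx.symm,
    left_assoc hh2Dx.symm, left_assoc hθh1, left_assoc hθh2, left_assoc hDθh2, neg_mul, mul_neg,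
    neg_neg, smul_neg, zero_mul, smul_zero, neg_zero, add_zero, sub_zero, mul_one]
    at hDx'θ' h2_Dx_x h2_Dθ_θ ⊢
  linear_combination (norm := module) hDx'θ' - b • h2_Dx_x + b • h2_Dθ_θ
    - p • hb • (h2 * (x * Dx) + h2 * (θ * Dθ))
end

section
/- Under the stated hypotheses, the unprimed derivative satisfies ∂θ·x = q·x∂θ − q·h1·(x∂x + θ∂θ). -/
/-- ∂θ·x = q·x∂θ − q·h₁·(x∂x + θ∂θ). -/
theorem h_superplane_Dtheta_x
    {K : Type*} [Field K] {R : Type*} [Ring R] [Algebra K R]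
    (p q : K) (hp : p ≠ 1) (hq : q ≠ 1)
    (x θ Dx Dθ h1 h2 : R)
    -- h1, h2 are odd parameters
    (hh1sq : h1 * h1 = 0) (hh2sq : h2 * h2 = 0)
    (hh12 : h1 * h2 = -(h2 * h1))
    -- h1, h2 commute with the even x, ∂x and anticommute with the odd θ, ∂θ
    (hh1x : h1 * x = x * h1) (hh2x : h2 * x = x * h2)
    (hh1Dx : h1 * Dx = Dx * h1) (hh2Dx : h2 * Dx = Dx * h2)
    (hh1θ : h1 * θ = -(θ * h1)) (hh2θ : h2 * θ = -(θ * h2))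
    (hh1Dθ : h1 * Dθ = -(Dθ * h1)) (hh2Dθ : h2 * Dθ = -(Dθ * h2))
    -- primed quantities
    (x' θ' Dx' Dθ' : R)
    (hx' : x' = x + ((p - 1)⁻¹ * (q - 1)⁻¹) • (h1 * h2 * x) + (p - 1)⁻¹ • (h1 * θ))
    (hθ' : θ' = θ + (q - 1)⁻¹ • (h2 * x))
    (hDx' : Dx' = Dx - (q - 1)⁻¹ • (h2 * Dθ))
    (hDθ' : Dθ' = (p - 1)⁻¹ • (h1 * Dx) +
      (Dθ - ((p - 1)⁻¹ * (q - 1)⁻¹) • (h1 * h2 * Dθ)))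
    -- (p,q)-deformed superplane calculus relations for the primed quantities
    (hplane : x' * θ' = q • (θ' * x'))
    (hθ'sq : θ' * θ' = 0)
    (hDx'x' : Dx' * x' = 1 + (p * q) • (x' * Dx') + (p * q - 1) • (θ' * Dθ'))
    (hDx'θ' : Dx' * θ' = p • (θ' * Dx'))
    (hDθ'x' : Dθ' * x' = q • (x' * Dθ'))
    (hDθ'θ' : Dθ' * θ' = 1 - θ' * Dθ')
    (hDD : Dθ' * Dx' = p • (Dx' * Dθ'))
    (hDθ'sq : Dθ' * Dθ' = 0) :
    Dθ * x = q • (x * Dθ) - q • (h1 * (x * Dx + θ * Dθ)) := by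
  have hp' : p - 1 ≠ 0 := sub_ne_zero.mpr hp
  -- rewriting rules that move `h1` and `h2` to the left, in this order
  have h1_sq (r : R) : h1 * (h1 * r) = 0 := by rw [← mul_assoc, hh1sq, zero_mul]
  have h2_h1 (r : R) : h2 * (h1 * r) = -(h1 * (h2 * r)) := by
    rw [← mul_assoc, ← mul_assoc, hh12, neg_mul, neg_neg]
  have x_h1 (r : R) : x * (h1 * r) = h1 * (x * r) := by rw [← mul_assoc, ← hh1x, mul_assoc]
  have x_h2 (r : R) : x * (h2 * r) = h2 * (x * r) := by rw [← mul_assoc, ← hh2x, mul_assoc]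
  have Dx_h1 (r : R) : Dx * (h1 * r) = h1 * (Dx * r) := by rw [← mul_assoc, ← hh1Dx, mul_assoc]
  have θ_h1 (r : R) : θ * (h1 * r) = -(h1 * (θ * r)) := by
    rw [← mul_assoc, ← mul_assoc, hh1θ, neg_mul, neg_neg]
  have Dθ_h1 (r : R) : Dθ * (h1 * r) = -(h1 * (Dθ * r)) := by
    rw [← mul_assoc, ← mul_assoc, hh1Dθ, neg_mul, neg_neg]
  have Dθ_h2 (r : R) : Dθ * (h2 * r) = -(h2 * (Dθ * r)) := by
    rw [← mul_assoc, ← mul_assoc, hh2Dθ, neg_mul, neg_neg]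
  have hmain : Dθ * x + (p - 1)⁻¹ • (h1 * (Dx * x) - h1 * (Dθ * θ)) =
      q • (x * Dθ + (p - 1)⁻¹ • (h1 * (x * Dx) + h1 * (θ * Dθ))) := by
    rw [hDθ', hx'] at hDθ'x'
    simp only [mul_add, add_mul, mul_sub, sub_mul, mul_assoc, mul_smul_comm, smul_mul_assoc,
      h1_sq, h2_h1, x_h1, x_h2, Dx_h1, θ_h1, Dθ_h1, Dθ_h2, mul_neg, neg_neg, neg_zero,
      smul_zero] at hDθ'x'
    linear_combination (norm := module) hDθ'x'
  have hDx : h1 * (Dx * x) - (q - 1)⁻¹ • (h1 * (h2 * (Dθ * x))) =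
      h1 + (p * q) • (h1 * (x * Dx) - (q - 1)⁻¹ • (h1 * (h2 * (x * Dθ)))) +
        (p * q - 1) • (h1 * (θ * Dθ) + (q - 1)⁻¹ • (h1 * (h2 * (x * Dθ)))) := by
    have h := congrArg (h1 * ·) hDx'x'
    rw [hDx', hx', hθ', hDθ'] at h
    simp only [mul_add, add_mul, mul_sub, sub_mul, mul_assoc, mul_smul_comm, smul_mul_assoc,
      h1_sq, h2_h1, x_h1, x_h2, Dx_h1, θ_h1, Dθ_h1, mul_neg, neg_zero,
      smul_zero, mul_one, add_zero, sub_zero, zero_add] at h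
    linear_combination (norm := module) h
  have hDθ : h1 * (Dθ * θ) - (q - 1)⁻¹ • (h1 * (h2 * (Dθ * x))) =
      h1 - (h1 * (θ * Dθ) + (q - 1)⁻¹ • (h1 * (h2 * (x * Dθ)))) := by
    have h := congrArg (h1 * ·) hDθ'θ'
    rw [hθ', hDθ'] at h
    simp only [mul_add, add_mul, mul_sub, sub_mul, mul_assoc, mul_smul_comm, smul_mul_assoc,
      h1_sq, h2_h1, x_h1, θ_h1, Dθ_h2, mul_neg, neg_zero,
      smul_zero, mul_one, add_zero, sub_zero, zero_add] at h
    linear_combination (norm := module) h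
  have hdiff : h1 * (Dx * x) - h1 * (Dθ * θ) =
      (p * q) • (h1 * (x * Dx) + h1 * (θ * Dθ)) := by
    linear_combination (norm := module) hDx - hDθ
  rw [hdiff] at hmain
  rw [mul_add, eq_sub_of_add_eq hmain]
  match_scalars <;> field_simp <;> ring
end

section
/- Under the stated hypotheses, the unprimed derivatives satisfy the commutation rules ∂θ∂x = p·∂x∂θ + h1·∂x² and (∂θ)² = h1·∂x∂θ. -/
/-- If `d`, `t` generate a `p`-deformed derivative plane and `h`, `k` are odd parameters, then the
derivatives obtained from them by the inverse contraction satisfy the `h`-deformed relations. -/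
theorem contraction_derivative_rels {K R : Type*} [Field K] [Ring R] [Algebra K R]
    {p a b : K} {d t h k : R} (ha : a * p = a + 1)
    (hh : h * h = 0) (kk : k * k = 0) (kh : k * h = -(h * k))
    (dh : d * h = h * d) (dk : d * k = k * d) (th : t * h = -(h * t)) (tk : t * k = -(k * t))
    (td : t * d = p • (d * t)) (tt : t * t = 0)
    {D T : R} (hD : D = d + (a * b) • (h * k * d) + b • (k * t)) (hT : T = t - a • (h * d)) :
    T * D = p • (D * T) + h * D ^ 2 ∧ T * T = h * (D * T) := by
  have hh_assoc (z : R) : h * (h * z) = 0 := by rw [← mul_assoc, hh, zero_mul]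
  have kk_assoc (z : R) : k * (k * z) = 0 := by rw [← mul_assoc, kk, zero_mul]
  have kh_assoc (z : R) : k * (h * z) = -(h * (k * z)) := by
    rw [← mul_assoc, kh, neg_mul, mul_assoc]
  have dh_assoc (z : R) : d * (h * z) = h * (d * z) := by rw [← mul_assoc, dh, mul_assoc]
  have dk_assoc (z : R) : d * (k * z) = k * (d * z) := by rw [← mul_assoc, dk, mul_assoc]
  have th_assoc (z : R) : t * (h * z) = -(h * (t * z)) := by
    rw [← mul_assoc, th, neg_mul, mul_assoc]
  have tk_assoc (z : R) : t * (k * z) = -(k * (t * z)) := by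
    rw [← mul_assoc, tk, neg_mul, mul_assoc]
  subst hD hT
  constructor <;>
    simp only [pow_two, mul_add, add_mul, mul_sub, sub_mul, smul_mul_assoc, mul_smul_comm,
      mul_assoc, td, tt, hh_assoc, kk_assoc, kh_assoc, dh_assoc,
      dk_assoc, th_assoc, tk_assoc, mul_neg, mul_zero, smul_zero, neg_zero]
  · linear_combination (norm := module) ha • (h * (d * d)) + (b * (1 + p) * ha) • (h * (k * (d * t)))
  · linear_combination (norm := module) ha • (h * (d * t))

/-- ∂θ∂x = p·∂x∂θ + h₁·∂x² and (∂θ)² = h₁·∂x∂θ. -/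
theorem h_superplane_derivative_rels
    {K : Type*} [Field K] {R : Type*} [Ring R] [Algebra K R]
    (p q : K) (hp : p ≠ 1) (hq : q ≠ 1)
    (x θ Dx Dθ h1 h2 : R)
    -- h1, h2 are odd parameters
    (hh1sq : h1 * h1 = 0) (hh2sq : h2 * h2 = 0)
    (hh12 : h1 * h2 = -(h2 * h1))
    -- h1, h2 commute with the even x, ∂x and anticommute with the odd θ, ∂θ
    (hh1x : h1 * x = x * h1) (hh2x : h2 * x = x * h2)
    (hh1Dx : h1 * Dx = Dx * h1) (hh2Dx : h2 * Dx = Dx * h2)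
    (hh1θ : h1 * θ = -(θ * h1)) (hh2θ : h2 * θ = -(θ * h2))
    (hh1Dθ : h1 * Dθ = -(Dθ * h1)) (hh2Dθ : h2 * Dθ = -(Dθ * h2))
    -- primed quantities
    (x' θ' Dx' Dθ' : R)
    (hx' : x' = x + ((p - 1)⁻¹ * (q - 1)⁻¹) • (h1 * h2 * x) + (p - 1)⁻¹ • (h1 * θ))
    (hθ' : θ' = θ + (q - 1)⁻¹ • (h2 * x))
    (hDx' : Dx' = Dx - (q - 1)⁻¹ • (h2 * Dθ))
    (hDθ' : Dθ' = (p - 1)⁻¹ • (h1 * Dx) +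
      (Dθ - ((p - 1)⁻¹ * (q - 1)⁻¹) • (h1 * h2 * Dθ)))
    -- (p,q)-deformed superplane calculus relations for the primed quantities
    (hplane : x' * θ' = q • (θ' * x'))
    (hθ'sq : θ' * θ' = 0)
    (hDx'x' : Dx' * x' = 1 + (p * q) • (x' * Dx') + (p * q - 1) • (θ' * Dθ'))
    (hDx'θ' : Dx' * θ' = p • (θ' * Dx'))
    (hDθ'x' : Dθ' * x' = q • (x' * Dθ'))
    (hDθ'θ' : Dθ' * θ' = 1 - θ' * Dθ')
    (hDD : Dθ' * Dx' = p • (Dx' * Dθ'))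
    (hDθ'sq : Dθ' * Dθ' = 0) :
    Dθ * Dx = p • (Dx * Dθ) + h1 * Dx ^ 2 ∧ Dθ * Dθ = h1 * (Dx * Dθ) := by
  have hp0 : p - 1 ≠ 0 := sub_ne_zero.mpr hp
  have ha : (p - 1)⁻¹ * p = (p - 1)⁻¹ + 1 := by field_simp; ring
  have hh2h1 : h2 * h1 = -(h1 * h2) := by rw [hh12, neg_neg]
  have hDθh1 : Dθ * h1 = -(h1 * Dθ) := by rw [hh1Dθ, neg_neg]
  have hDθh2 : Dθ * h2 = -(h2 * Dθ) := by rw [hh2Dθ, neg_neg]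
  have h1h1_assoc (z : R) : h1 * (h1 * z) = 0 := by rw [← mul_assoc, hh1sq, zero_mul]
  have h2h2_assoc (z : R) : h2 * (h2 * z) = 0 := by rw [← mul_assoc, hh2sq, zero_mul]
  have h2h1_assoc (z : R) : h2 * (h1 * z) = -(h1 * (h2 * z)) := by
    rw [← mul_assoc, hh2h1, neg_mul, mul_assoc]
  refine contraction_derivative_rels (b := (q - 1)⁻¹) ha hh1sq hh2sq hh2h1
    (d := Dx') (t := Dθ') ?_ ?_ ?_ ?_ hDD hDθ'sq ?_ ?_ <;>
  · simp only [hDx', hDθ', mul_add, add_mul, mul_sub, sub_mul, smul_mul_assoc, mul_smul_comm,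
      mul_assoc, ← hh1Dx, ← hh2Dx, hDθh1, hDθh2, h1h1_assoc, h2h2_assoc,
      h2h1_assoc, mul_neg, mul_zero, smul_zero, neg_zero]
    try module
end

section
/- Under the stated hypotheses, the unprimed derivatives and differentials satisfy ∂x·dx = pq·dx∂x + h1·dθ∂x − h2·dx∂θ + h1h2·(dx∂x + dθ∂θ) + (pq−1)·dθ∂θ, and ∂x·dθ = p·dθ∂x + p·h2·(dx∂x + dθ∂θ). -/
/-- ∂x·dx = pq·dx∂x + h₁·dθ∂x − h₂·dx∂θ + h₁h₂·(dx∂x + dθ∂θ) + (pq−1)·dθ∂θ, and ∂x·dθ = p·dθ∂x + p·h₂·(dx∂x + dθ∂θ). -/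
theorem h_superplane_Dx_differentials
    {K : Type*} [Field K] {R : Type*} [Ring R] [Algebra K R]
    (p q : K) (hp : p ≠ 1) (hq : q ≠ 1)
    (dx dθ Dx Dθ dx' dθ' Dx' Dθ' h1 h2 : R)
    -- h1, h2 are odd parameters
    (hh1sq : h1 * h1 = 0) (hh2sq : h2 * h2 = 0)
    (hh12 : h1 * h2 = -(h2 * h1))
    -- h1, h2 commute with the even dθ', ∂x and anticommute with the odd dx', ∂θ
    (hh1dθ' : h1 * dθ' = dθ' * h1) (hh2dθ' : h2 * dθ' = dθ' * h2)
    (hh1Dx : h1 * Dx = Dx * h1) (hh2Dx : h2 * Dx = Dx * h2)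
    (hh1dx' : h1 * dx' = -(dx' * h1)) (hh2dx' : h2 * dx' = -(dx' * h2))
    (hh1Dθ : h1 * Dθ = -(Dθ * h1)) (hh2Dθ : h2 * Dθ = -(Dθ * h2))
    -- contraction relations
    (hdx : dx = dx' + (p - 1)⁻¹ • (h1 * dθ'))
    (hdθ : dθ = (q - 1)⁻¹ • (h2 * dx') +
      (dθ' - ((p - 1)⁻¹ * (q - 1)⁻¹) • (h1 * h2 * dθ')))
    (hDx' : Dx' = Dx - (q - 1)⁻¹ • (h2 * Dθ))
    (hDθ' : Dθ' = (p - 1)⁻¹ • (h1 * Dx) +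
      (Dθ - ((p - 1)⁻¹ * (q - 1)⁻¹) • (h1 * h2 * Dθ)))
    -- primed (p,q)-calculus relations between derivatives and differentials
    (hDx'dx' : Dx' * dx' = (p * q) • (dx' * Dx') + (p * q - 1) • (dθ' * Dθ'))
    (hDx'dθ' : Dx' * dθ' = p • (dθ' * Dx'))
    (hDθ'dx' : Dθ' * dx' = -(q • (dx' * Dθ')))
    (hDθ'dθ' : Dθ' * dθ' = dθ' * Dθ') :
    Dx * dx = (p * q) • (dx * Dx) + h1 * (dθ * Dx) - h2 * (dx * Dθ) + h1 * h2 * (dx * Dx + dθ * Dθ) + (p * q - 1) • (dθ * Dθ) ∧ Dx * dθ = p • (dθ * Dx) + p • (h2 * (dx * Dx + dθ * Dθ)) := by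
  have hp' : p - 1 ≠ 0 := sub_ne_zero.mpr hp
  have hq' : q - 1 ≠ 0 := sub_ne_zero.mpr hq
  have hh21 : h2 * h1 = -(h1 * h2) := by rw [hh12, neg_neg]
  have assoc_rule {a b c : R} (h : a * b = c) (z : R) : a * (b * z) = c * z := by
    rw [← mul_assoc, h]
  have Dx_h1 := hh1Dx.symm
  have Dx_h2 := hh2Dx.symm
  have Dθ_h1 : Dθ * h1 = -(h1 * Dθ) := by rw [hh1Dθ, neg_neg]
  have Dθ_h2 : Dθ * h2 = -(h2 * Dθ) := by rw [hh2Dθ, neg_neg]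
  have dx'_h1 : dx' * h1 = -(h1 * dx') := by rw [hh1dx', neg_neg]
  have dx'_h2 : dx' * h2 = -(h2 * dx') := by rw [hh2dx', neg_neg]
  -- the odd parameters (anti)commute with the primed derivatives as well
  have Dx'_h1 : Dx' * h1 = h1 * Dx' := by
    simp only [hDx', sub_mul, mul_sub, smul_mul_assoc, mul_smul_comm, mul_assoc, Dx_h1, Dθ_h1,
      mul_neg, neg_mul, assoc_rule hh21, neg_neg]
  have Dx'_h2 : Dx' * h2 = h2 * Dx' := by
    simp only [hDx', sub_mul, mul_sub, smul_mul_assoc, mul_smul_comm, mul_assoc, Dx_h2, Dθ_h2,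
      mul_neg, assoc_rule hh2sq, zero_mul, neg_zero]
  have Dθ'_h1 : Dθ' * h1 = -(h1 * Dθ') := by
    simp only [hDθ', add_mul, sub_mul, mul_add, mul_sub, smul_mul_assoc, mul_smul_comm, mul_assoc,
      Dx_h1, Dθ_h1, mul_neg, neg_mul, assoc_rule hh21, assoc_rule hh1sq, zero_mul, neg_zero,
      smul_zero, zero_add, sub_zero]
  have Dθ'_h2 : Dθ' * h2 = -(h2 * Dθ') := by
    simp only [hDθ', add_mul, sub_mul, mul_add, mul_sub, smul_mul_assoc, mul_smul_comm, mul_assoc,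
      Dx_h2, Dθ_h2, mul_neg, neg_mul, assoc_rule hh21, assoc_rule hh2sq, zero_mul, mul_zero,
      neg_zero, smul_zero, sub_zero, smul_neg, neg_add, neg_neg]
  -- inverting the contraction relations for the derivatives
  have Dθ_eq : Dθ = Dθ' - (p - 1)⁻¹ • (h1 * Dx') := by
    rw [hDθ', hDx']
    simp only [mul_sub, mul_smul_comm, mul_assoc]
    module
  have Dx_eq : Dx = Dx' + (q - 1)⁻¹ • (h2 * Dθ') +
      ((p - 1)⁻¹ * (q - 1)⁻¹) • (h1 * (h2 * Dx')) := by
    have key : Dx = Dx' + (q - 1)⁻¹ • (h2 * Dθ) := by rw [hDx', sub_add_cancel]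
    rw [key, Dθ_eq]
    simp only [mul_sub, mul_smul_comm, assoc_rule hh21, neg_mul, mul_assoc]
    module
  -- normal ordering: parameters, then differentials, then derivatives
  constructor <;>
  · rw [hdx, hdθ, Dx_eq, Dθ_eq]
    simp only [add_mul, sub_mul, mul_add, mul_sub, smul_mul_assoc, mul_smul_comm, mul_assoc,
      mul_neg, neg_mul, neg_neg, mul_zero, zero_mul, smul_zero, neg_zero,
      hDx'dx', hDx'dθ', hDθ'dx', hDθ'dθ',
      assoc_rule Dx'_h1, assoc_rule Dx'_h2, assoc_rule Dθ'_h1, assoc_rule Dθ'_h2,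
      assoc_rule dx'_h1, assoc_rule dx'_h2, assoc_rule hh1dθ'.symm, assoc_rule hh2dθ'.symm,
      assoc_rule hh21, assoc_rule hh1sq, assoc_rule hh2sq]
    match_scalars <;> field_simp <;> ring
end

section
/- Under the stated hypotheses, the operators T = x∂x + θ∂θ and ∇ = x∂θ satisfy T∇ = ∇T and ∇² = 0. -/
/-- The operators T = x∂x + θ∂θ and ∇ = x∂θ satisfy T∇ = ∇T and ∇² = 0. -/
theorem h_superplane_T_nabla_algebra
    {K : Type*} [Field K] {R : Type*} [Ring R] [Algebra K R]
    (x θ Dx Dθ h1 h2 : R)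
    -- h1, h2 are odd parameters
    (hh1sq : h1 * h1 = 0) (hh2sq : h2 * h2 = 0)
    (hh12 : h1 * h2 = -(h2 * h1))
    -- h1, h2 commute with the even x, ∂x and anticommute with the odd θ, ∂θ
    (hh1x : h1 * x = x * h1) (hh2x : h2 * x = x * h2)
    (hh1Dx : h1 * Dx = Dx * h1) (hh2Dx : h2 * Dx = Dx * h2)
    (hh1θ : h1 * θ = -(θ * h1)) (hh2θ : h2 * θ = -(θ * h2))
    (hh1Dθ : h1 * Dθ = -(Dθ * h1)) (hh2Dθ : h2 * Dθ = -(Dθ * h2))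
    -- (h1,h2)-deformed superplane calculus relations
    (hxθ : x * θ = θ * x + h2 * x ^ 2)
    (hθsq : θ * θ = -(h2 * (θ * x)))
    (hDxx : Dx * x = 1 + x * Dx - h1 * (θ * Dx) + h2 * (x * Dθ) +
      h1 * h2 * (x * Dx + θ * Dθ))
    (hDxθ : Dx * θ = θ * Dx - h2 * (x * Dx + θ * Dθ))
    (hDθx : Dθ * x = x * Dθ - h1 * (x * Dx + θ * Dθ))
    (hDθθ : Dθ * θ = 1 - θ * Dθ - h1 * (θ * Dx) + h2 * (x * Dθ) +
      h1 * h2 * (x * Dx + θ * Dθ))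
    (hDD : Dx * Dθ = Dθ * Dx - h1 * Dx ^ 2)
    (hDθsq : Dθ * Dθ = h1 * (Dθ * Dx))
    -- the operators T and ∇
    (T Nb : R)
    (hT : T = x * Dx + θ * Dθ)
    (hNb : Nb = x * Dθ) :
    T * Nb = Nb * T ∧ Nb * Nb = 0 := by
  have mul_tail {a b c : R} (h : a * b = c) (r : R) : a * (b * r) = c * r := by
    rw [← mul_assoc, h]
  have r21 : h2 * h1 = -(h1 * h2) := by rw [hh12, neg_neg]
  have rθ1 : θ * h1 = -(h1 * θ) := by rw [hh1θ, neg_neg]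
  subst hT hNb
  constructor <;>
  · simp only [pow_two, mul_assoc, mul_add, add_mul, mul_sub, sub_mul, neg_mul, mul_neg, neg_neg,
      one_mul, zero_mul, neg_zero, add_zero, sub_zero, mul_tail hh1sq, mul_tail r21,
      mul_tail hh1x.symm, mul_tail hh2x.symm, mul_tail rθ1,
      mul_tail hxθ, mul_tail hDxx, mul_tail hDθx, mul_tail hDθθ, hDD, hDθsq]
    abel
end

section
/- Under the stated hypotheses, the transformed coordinates x̃ = ax + βθ and θ̃ = γx + dθ again satisfy the h-superplane relations: x̃θ̃ = θ̃x̃ + h2·x̃² and θ̃² = −h2·θ̃x̃; that is, the coaction of GL_{h1,h2}(1|1) preserves the h-superplane relations. -/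
/-- The coaction of GL_{h₁,h₂}(1|1) preserves the h-superplane relations:
    xt = ax + βθ and θt = γx + dθ again satisfy xtθt = θtxt + h₂·xt² and
    θt² = −h₂·θtxt. -/
theorem GLh_coaction_preserves_h_superplane
    {K : Type*} [Field K] {R : Type*} [Ring R] [Algebra K R]
    (x θ h1 h2 a β γ d : R)
    -- h1, h2 are odd parameters
    (hh1sq : h1 * h1 = 0) (hh2sq : h2 * h2 = 0)
    (hh12 : h1 * h2 = -(h2 * h1))
    -- h1, h2 commute with the even x and anticommute with the odd θ
    (hh1x : h1 * x = x * h1) (hh2x : h2 * x = x * h2)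
    (hh1θ : h1 * θ = -(θ * h1)) (hh2θ : h2 * θ = -(θ * h2))
    -- the h-superplane relations
    (hxθ : x * θ = θ * x + h2 * x ^ 2)
    (hθsq : θ * θ = -(h2 * (θ * x)))
    -- the even entries a, d commute with x, θ, h1 and h2
    (hax : a * x = x * a) (haθ : a * θ = θ * a)
    (hah1 : a * h1 = h1 * a) (hah2 : a * h2 = h2 * a)
    (hdx : d * x = x * d) (hdθ : d * θ = θ * d)
    (hdh1 : d * h1 = h1 * d) (hdh2 : d * h2 = h2 * d)
    -- the odd entries β, γ commute with x and anticommute with θ, h1, h2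
    (hβx : β * x = x * β) (hβθ : β * θ = -(θ * β))
    (hβh1 : β * h1 = -(h1 * β)) (hβh2 : β * h2 = -(h2 * β))
    (hγx : γ * x = x * γ) (hγθ : γ * θ = -(θ * γ))
    (hγh1 : γ * h1 = -(h1 * γ)) (hγh2 : γ * h2 = -(h2 * γ))
    -- the GL_{h1,h2}(1|1) relations
    (haβ : a * β = β * a - h1 * (a ^ 2 - β * γ - a * d))
    (hdβ : d * β = β * d + h1 * (d ^ 2 + β * γ - d * a))
    (haγ : a * γ = γ * a + h2 * (a ^ 2 + γ * β - a * d))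
    (hdγ : d * γ = γ * d - h2 * (d ^ 2 - γ * β - d * a))
    (hβsq : β * β = h1 * β * (a - d))
    (hγsq : γ * γ = h2 * γ * (d - a))
    (hβγ : β * γ = -(γ * β) + (h1 * γ - h2 * β) * (a - d))
    (had : a * d = d * a + h1 * (a - d) * γ + h2 * β * (a - d))
    -- the transformed coordinates
    (xt θt : R)
    (hxtdef : xt = a * x + β * θ)
    (hθtdef : θt = γ * x + d * θ) :
    xt * θt = θt * xt + h2 * xt ^ 2 ∧ θt * θt = -(h2 * (θt * xt)) := by
  have hmul : xt * θt = (a * γ + h2 * (a * d)) * x ^ 2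
      + (a * d - β * γ + h2 * (β * d)) * (θ * x) := by
    subst hxtdef hθtdef
    linear_combination (norm := noncomm_ring) -(a * hγx * x) - a * hdx * θ + a * d * hxθ
      + hah2 * d * x ^ 2 + a * hdh2 * x ^ 2 + β * hγθ * x - β * hdθ * θ + β * d * hθsq
      - hβh2 * d * θ * x - β * hdh2 * θ * x
  have hmul_swap : θt * xt = (γ * a + h2 * (γ * β)) * x ^ 2
      + (γ * β + d * a - h2 * (d * β)) * (θ * x) := by
    subst hxtdef hθtdef
    linear_combination (norm := noncomm_ring) -(γ * hax * x) - γ * hβx * θ + γ * β * hxθ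
      + γ * hβh2 * x ^ 2 - hγh2 * β * x ^ 2 - d * haθ * x + d * hβθ * θ - d * β * hθsq
      + d * hβh2 * θ * x - hdh2 * β * θ * x
  have hsq : h2 * xt ^ 2 = h2 * a ^ 2 * x ^ 2 + h2 * (a * β + β * a) * (θ * x) := by
    subst hxtdef
    linear_combination (norm := noncomm_ring) -(h2 * a * hax * x) - h2 * a * hβx * θ
      + h2 * a * β * hxθ - h2 * β * haθ * x + h2 * β * hβθ * θ - h2 * β * β * hθsq
      + h2 * a * hβh2 * x ^ 2 - h2 * hah2 * β * x ^ 2 - hh2sq * a * β * x ^ 2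
      + h2 * β * hβh2 * θ * x - h2 * hβh2 * β * θ * x + hh2sq * β * β * θ * x
  have hθt_sq : θt * θt = (γ * γ - h2 * (γ * d)) * x ^ 2
      + (γ * d - d * γ - h2 * d ^ 2) * (θ * x) := by
    subst hθtdef
    linear_combination (norm := noncomm_ring) -(γ * hγx * x) - γ * hdx * θ + γ * d * hxθ
      + γ * hdh2 * x ^ 2 + hγh2 * d * x ^ 2 + d * hγθ * x - d * hdθ * θ + d * d * hθsq
      - d * hdh2 * θ * x - hdh2 * d * θ * x
  constructor
  · have hcoeff : a * d - β * γ + h2 * (β * d)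
        = γ * β + d * a - h2 * (d * β) + h2 * (a * β + β * a) := by
      linear_combination (norm := noncomm_ring) had - hβγ + h1 * haγ - h1 * hdγ - h2 * haβ
        + h2 * hdβ + hh12 * (a ^ 2 + d ^ 2 - a * d - d * a)
    rw [hmul, hmul_swap, hsq]
    linear_combination (norm := noncomm_ring) haγ * x ^ 2 + hcoeff * (θ * x)
  · rw [hθt_sq, hmul_swap]
    linear_combination (norm := noncomm_ring) hγsq * x ^ 2 - hdγ * (θ * x)
      + hh2sq * γ * β * x ^ 2 - hh2sq * d * β * (θ * x)
end

section
/- Under the stated hypotheses, the transformed differentials φ̃ = aφ − βy and ỹ = −γφ + dy again satisfy the dual h-superplane relations: φ̃ỹ = ỹφ̃ + h1·ỹ² and φ̃² = h1·φ̃ỹ; that is, the coaction of GL_{h1,h2}(1|1) preserves the dual h-superplane relations. -/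
/-- Swapping the inner factors of a product of products when they anticommute. -/
theorem mul_mul_mul_anticomm {R : Type*} [Ring R] {u q : R} (h : q * u = -(u * q)) (p v : R) :
    p * u * (q * v) = -(p * q * (u * v)) := by
  have h' : u * q = -(q * u) := by rw [h, neg_neg]
  calc p * u * (q * v) = p * (u * q) * v := by noncomm_ring
    _ = -(p * q * (u * v)) := by rw [h']; noncomm_ring

/-- The coaction of GL_{h₁,h₂}(1|1) preserves the dual h-superplane relations:
    φ̃ = aφ − βy and ỹ = −γφ + dy again satisfy φ̃ỹ = ỹφ̃ + h₁·ỹ² and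
    φ̃² = h₁·φ̃ỹ. -/
theorem GLh_coaction_preserves_dual_h_superplane
    {K : Type*} [Field K] {R : Type*} [Ring R] [Algebra K R]
    (φ y h1 h2 a β γ d : R)
    -- h1, h2 are odd parameters
    (hh1sq : h1 * h1 = 0) (hh2sq : h2 * h2 = 0)
    (hh12 : h1 * h2 = -(h2 * h1))
    -- h1, h2 anticommute with the odd φ and commute with the even y
    (hh1φ : h1 * φ = -(φ * h1)) (hh2φ : h2 * φ = -(φ * h2))
    (hh1y : h1 * y = y * h1) (hh2y : h2 * y = y * h2)
    -- the dual h-superplane relations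
    (hφy : φ * y = y * φ + h1 * y ^ 2)
    (hφsq : φ * φ = h1 * (φ * y))
    -- the even entries a, d commute with φ, y, h1 and h2
    (haφ : a * φ = φ * a) (hay : a * y = y * a)
    (hah1 : a * h1 = h1 * a) (hah2 : a * h2 = h2 * a)
    (hdφ : d * φ = φ * d) (hdy : d * y = y * d)
    (hdh1 : d * h1 = h1 * d) (hdh2 : d * h2 = h2 * d)
    -- the odd entries β, γ commute with y and anticommute with φ, h1, h2
    (hβy : β * y = y * β) (hβφ : β * φ = -(φ * β))
    (hβh1 : β * h1 = -(h1 * β)) (hβh2 : β * h2 = -(h2 * β))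
    (hγy : γ * y = y * γ) (hγφ : γ * φ = -(φ * γ))
    (hγh1 : γ * h1 = -(h1 * γ)) (hγh2 : γ * h2 = -(h2 * γ))
    -- the GL_{h1,h2}(1|1) relations
    (haβ : a * β = β * a - h1 * (a ^ 2 - β * γ - a * d))
    (hdβ : d * β = β * d + h1 * (d ^ 2 + β * γ - d * a))
    (haγ : a * γ = γ * a + h2 * (a ^ 2 + γ * β - a * d))
    (hdγ : d * γ = γ * d - h2 * (d ^ 2 - γ * β - d * a))
    (hβsq : β * β = h1 * β * (a - d))
    (hγsq : γ * γ = h2 * γ * (d - a))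
    (hβγ : β * γ = -(γ * β) + (h1 * γ - h2 * β) * (a - d))
    (had : a * d = d * a + h1 * (a - d) * γ + h2 * β * (a - d))
    -- the transformed differentials
    (φt yt : R)
    (hφtdef : φt = a * φ - β * y)
    (hytdef : yt = -(γ * φ) + d * y) :
    φt * yt = yt * φt + h1 * yt ^ 2 ∧ φt * φt = h1 * (φt * yt) := by
  have hyφ : y * φ = φ * y - h1 * (y * y) := by rw [hφy]; noncomm_ring
  have cφ {q : R} (h : q * φ = φ * q) (p v : R) : p * φ * (q * v) = p * q * (φ * v) :=
    Commute.mul_mul_mul_comm h.symm p v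
  have cy {q : R} (h : q * y = y * q) (p v : R) : p * y * (q * v) = p * q * (y * v) :=
    Commute.mul_mul_mul_comm h.symm p v
  have h1_cancel (u v : R) (h : u * h1 = h1 * u ∨ u * h1 = -(h1 * u)) :
      h1 * (u * (h1 * v)) = 0 := by
    rw [← mul_assoc u]
    rcases h with h | h <;> rw [h] <;> simp [← mul_assoc, hh1sq]
  -- Products of the transformed differentials, with the entries moved to the left.
  have hφφ : φt * φt = a * a * (φ * φ) + a * β * (φ * y) - β * a * (y * φ)
      + β * β * (y * y) := by
    rw [hφtdef, sub_mul, mul_sub, mul_sub, cφ haφ, mul_mul_mul_anticomm hβφ, cy hay, cy hβy]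
    abel
  have hφy' : φt * yt = a * γ * (φ * φ) + a * d * (φ * y) + β * γ * (y * φ)
      - β * d * (y * y) := by
    rw [hφtdef, hytdef, sub_mul, mul_add, mul_add, mul_neg, mul_neg,
      mul_mul_mul_anticomm hγφ, cφ hdφ, cy hγy, cy hdy]
    abel
  have hyφ' : yt * φt = -(γ * a * (φ * φ)) - γ * β * (φ * y) + d * a * (y * φ)
      - d * β * (y * y) := by
    rw [hφtdef, hytdef, add_mul, mul_sub, mul_sub, neg_mul, neg_mul,
      mul_mul_mul_anticomm hβφ, cφ haφ, cy hay, cy hβy]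
    abel
  have hyy : yt * yt = -(γ * γ * (φ * φ)) - γ * d * (φ * y) - d * γ * (y * φ)
      + d * d * (y * y) := by
    rw [hytdef, add_mul, mul_add, mul_add, neg_mul, neg_mul, mul_neg, mul_neg,
      mul_mul_mul_anticomm hγφ, cφ hdφ, cy hγy, cy hdy]
    abel
  -- Entries of even or odd degree moved past `h1`.
  have even_even {p q : R} (hp : p * h1 = h1 * p) (hq : q * h1 = h1 * q) :
      p * q * h1 = h1 * (p * q) := by
    rw [mul_assoc, hq, ← mul_assoc, hp, mul_assoc]
  have even_odd {p q : R} (hp : p * h1 = h1 * p) (hq : q * h1 = -(h1 * q)) :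
      p * q * h1 = -(h1 * (p * q)) := by
    rw [mul_assoc, hq, mul_neg, ← mul_assoc, hp, mul_assoc]
  have odd_even {p q : R} (hp : p * h1 = -(h1 * p)) (hq : q * h1 = h1 * q) :
      p * q * h1 = -(h1 * (p * q)) := by
    rw [mul_assoc, hq, ← mul_assoc, hp, neg_mul, mul_assoc]
  have odd_odd {p q : R} (hp : p * h1 = -(h1 * p)) (hq : q * h1 = -(h1 * q)) :
      p * q * h1 = h1 * (p * q) := by
    rw [mul_assoc, hq, mul_neg, ← mul_assoc, hp, neg_mul, neg_neg, mul_assoc]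
  constructor
  · have hsq : h1 * yt ^ 2 = h1 * (-(γ * d + d * γ) * (φ * y) + d * d * (y * y)) := by
      have e₁ := h1_cancel (γ * γ) (φ * y) (.inl (odd_odd hγh1 hγh1))
      have e₂ := h1_cancel (d * γ) (y * y) (.inr (even_odd hdh1 hγh1))
      rw [pow_two, hyy, hφsq, hyφ]
      simp only [mul_add, mul_sub, mul_neg, e₁, e₂, add_mul, neg_mul]
      abel
    have coeff_φy : -(h1 * (a * γ)) - h1 * (γ * a) + a * d + β * γ + γ * β - d * a
        + h1 * (γ * d + d * γ) = 0 := by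
      rw [had, hβγ]; noncomm_ring
    have coeff_yy : -(h1 * (β * γ)) + h1 * (d * a) - β * d + d * β - h1 * (d * d) = 0 := by
      rw [hdβ]; noncomm_ring
    rw [hsq, hφy', hyφ', hφsq, hyφ, ← sub_eq_zero]
    simp only [mul_sub, ← mul_assoc _ h1, even_odd hah1 hγh1, odd_even hγh1 hah1,
      odd_odd hβh1 hγh1, even_even hdh1 hah1]
    calc _ = (-(h1 * (a * γ)) - h1 * (γ * a) + a * d + β * γ + γ * β - d * a
          + h1 * (γ * d + d * γ)) * (φ * y)
        + (-(h1 * (β * γ)) + h1 * (d * a) - β * d + d * β - h1 * (d * d)) * (y * y) := by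
          noncomm_ring
      _ = 0 := by rw [coeff_φy, coeff_yy, zero_mul, zero_mul, add_zero]
  · have hprod : h1 * (φt * yt) = h1 * ((a * d + β * γ) * (φ * y) - β * d * (y * y)) := by
      have e₁ := h1_cancel (a * γ) (φ * y) (.inr (even_odd hah1 hγh1))
      have e₂ := h1_cancel (β * γ) (y * y) (.inl (odd_odd hβh1 hγh1))
      rw [hφy', hφsq, hyφ]
      simp only [mul_add, mul_sub, e₁, e₂, add_mul]
      abel
    have coeff_φy : h1 * (a * a) + a * β - β * a - h1 * (a * d + β * γ) = 0 := by
      rw [haβ]; noncomm_ring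
    have coeff_yy : -(h1 * (β * a)) + β * β + h1 * (β * d) = 0 := by
      rw [hβsq]; noncomm_ring
    rw [hprod, hφφ, hφsq, hyφ, ← sub_eq_zero]
    simp only [mul_sub, ← mul_assoc _ h1, even_even hah1 hah1, odd_even hβh1 hah1]
    calc _ = (h1 * (a * a) + a * β - β * a - h1 * (a * d + β * γ)) * (φ * y)
        + (-(h1 * (β * a)) + β * β + h1 * (β * d)) * (y * y) := by noncomm_ring
      _ = 0 := by rw [coeff_φy, coeff_yy, zero_mul, zero_mul, add_zero]
end

section
/- Under the stated hypotheses, the hermitean phase-space operators satisfy: x̂θ̂ = θ̂x̂ + h2·x̂², θ̂² = −h2·θ̂x̂, p̂x·p̂θ = p̂θ·p̂x + i·h1·p̂x², and p̂θ² = −i·h1·p̂x·p̂θ. -/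
/-- A rewriting rule for the product of two elements extends to right-associated products. -/
theorem mul_mul_eq_of_mul_eq {S : Type*} [Semigroup S] {a b c : S} (h : a * b = c) (t : S) :
    a * (b * t) = c * t := by
  rw [← h, mul_assoc]

/-- Coordinate relations of the deformed superplane are stable under the hermitean redefinition
of the coordinates. -/
theorem hermitean_coordinate_rels {R : Type*} [Ring R] {x θ h1 h2 : R}
    (h1_sq : h1 * h1 = 0) (h2_sq : h2 * h2 = 0) (h2_h1 : h2 * h1 = -(h1 * h2))
    (x_h1 : x * h1 = h1 * x) (x_h2 : x * h2 = h2 * x)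
    (θ_h1 : θ * h1 = -(h1 * θ)) (θ_h2 : θ * h2 = -(h2 * θ))
    (x_θ : x * θ = θ * x + h2 * x ^ 2) (θ_sq : θ * θ = -(h2 * (θ * x))) :
    ((1 + h1 * h2) * x + h1 * θ) * ((1 - h1 * h2) * θ + h2 * x) =
        ((1 - h1 * h2) * θ + h2 * x) * ((1 + h1 * h2) * x + h1 * θ) +
          h2 * ((1 + h1 * h2) * x + h1 * θ) ^ 2 ∧
      ((1 - h1 * h2) * θ + h2 * x) * ((1 - h1 * h2) * θ + h2 * x) =
        -(h2 * (((1 - h1 * h2) * θ + h2 * x) * ((1 + h1 * h2) * x + h1 * θ))) := by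
  constructor <;>
  · simp only [pow_two, mul_add, add_mul, mul_sub, sub_mul, one_mul, mul_assoc, neg_mul, mul_neg, neg_neg,
      mul_zero, neg_zero, zero_mul, x_θ, θ_sq, mul_mul_eq_of_mul_eq h1_sq,
      mul_mul_eq_of_mul_eq h2_sq, mul_mul_eq_of_mul_eq h2_h1, mul_mul_eq_of_mul_eq x_h1,
      mul_mul_eq_of_mul_eq x_h2, mul_mul_eq_of_mul_eq θ_h1, mul_mul_eq_of_mul_eq θ_h2]
    abel

/-- Derivative relations of the deformed superplane are stable under the redefinition of the
derivatives that makes them hermitean up to a scalar. -/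
theorem hermitean_derivative_rels {R : Type*} [Ring R] {Dx Dθ h1 h2 : R}
    (h1_sq : h1 * h1 = 0) (h2_sq : h2 * h2 = 0) (h2_h1 : h2 * h1 = -(h1 * h2))
    (Dx_h1 : Dx * h1 = h1 * Dx) (Dx_h2 : Dx * h2 = h2 * Dx)
    (Dθ_h1 : Dθ * h1 = -(h1 * Dθ)) (Dθ_h2 : Dθ * h2 = -(h2 * Dθ))
    (Dx_Dθ : Dx * Dθ = Dθ * Dx - h1 * Dx ^ 2) (Dθ_sq : Dθ * Dθ = h1 * (Dθ * Dx)) :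
    ((1 + h1 * h2) * Dx - h2 * Dθ) * ((1 - h1 * h2) * Dθ + h1 * Dx) =
        ((1 - h1 * h2) * Dθ + h1 * Dx) * ((1 + h1 * h2) * Dx - h2 * Dθ) -
          h1 * ((1 + h1 * h2) * Dx - h2 * Dθ) ^ 2 ∧
      ((1 - h1 * h2) * Dθ + h1 * Dx) * ((1 - h1 * h2) * Dθ + h1 * Dx) =
        h1 * (((1 + h1 * h2) * Dx - h2 * Dθ) * ((1 - h1 * h2) * Dθ + h1 * Dx)) := by
  constructor <;>
  · simp only [pow_two, mul_add, add_mul, mul_sub, sub_mul, one_mul, mul_assoc, neg_mul, mul_neg, neg_neg,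
      mul_zero, neg_zero, zero_mul, Dx_Dθ, Dθ_sq, mul_mul_eq_of_mul_eq h1_sq,
      mul_mul_eq_of_mul_eq h2_sq, mul_mul_eq_of_mul_eq h2_h1, mul_mul_eq_of_mul_eq Dx_h1,
      mul_mul_eq_of_mul_eq Dx_h2, mul_mul_eq_of_mul_eq Dθ_h1, mul_mul_eq_of_mul_eq Dθ_h2]
    abel


/-- x̂θ̂ = θ̂x̂ + h₂·x̂², θ̂² = −h₂·θ̂x̂, p̂x·p̂θ = p̂θ·p̂x + i·h₁·p̂x², and p̂θ² = −i·h₁·p̂x·p̂θ. -/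
theorem h_phase_space_coordinate_momentum_rels
    {R : Type*} [Ring R] [Algebra ℂ R]
    (x θ Dx Dθ h1 h2 : R)
    -- h1, h2 are odd parameters
    (hh1sq : h1 * h1 = 0) (hh2sq : h2 * h2 = 0)
    (hh12 : h1 * h2 = -(h2 * h1))
    -- h1, h2 commute with the even x, ∂x and anticommute with the odd θ, ∂θ
    (hh1x : h1 * x = x * h1) (hh2x : h2 * x = x * h2)
    (hh1Dx : h1 * Dx = Dx * h1) (hh2Dx : h2 * Dx = Dx * h2)
    (hh1θ : h1 * θ = -(θ * h1)) (hh2θ : h2 * θ = -(θ * h2))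
    (hh1Dθ : h1 * Dθ = -(Dθ * h1)) (hh2Dθ : h2 * Dθ = -(Dθ * h2))
    -- (h1,h2)-deformed superplane calculus relations
    (hxθ : x * θ = θ * x + h2 * x ^ 2)
    (hθsq : θ * θ = -(h2 * (θ * x)))
    (hDxx : Dx * x = 1 + x * Dx - h1 * (θ * Dx) + h2 * (x * Dθ) +
      h1 * h2 * (x * Dx + θ * Dθ))
    (hDxθ : Dx * θ = θ * Dx - h2 * (x * Dx + θ * Dθ))
    (hDθx : Dθ * x = x * Dθ - h1 * (x * Dx + θ * Dθ))
    (hDθθ : Dθ * θ = 1 - θ * Dθ - h1 * (θ * Dx) + h2 * (x * Dθ) +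
      h1 * h2 * (x * Dx + θ * Dθ))
    (hDD : Dx * Dθ = Dθ * Dx - h1 * Dx ^ 2)
    (hDθsq : Dθ * Dθ = h1 * (Dθ * Dx))
    -- the hermitean operators and momenta
    (X Θ Px Pθ : R)
    (hX : X = (1 + h1 * h2) * x + h1 * θ)
    (hΘ : Θ = (1 - h1 * h2) * θ + h2 * x)
    (hPx : Px = Complex.I • ((1 + h1 * h2) * Dx - h2 * Dθ))
    (hPθ : Pθ = (1 - h1 * h2) * Dθ + h1 * Dx) :
    X * Θ = Θ * X + h2 * X ^ 2 ∧ Θ * Θ = -(h2 * (Θ * X)) ∧ Px * Pθ = Pθ * Px + Complex.I • (h1 * Px ^ 2) ∧ Pθ * Pθ = -(Complex.I • (h1 * (Px * Pθ))) := by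
  have h2_h1 : h2 * h1 = -(h1 * h2) := by rw [hh12, neg_neg]
  obtain ⟨coord_comm, coord_sq⟩ := hermitean_coordinate_rels hh1sq hh2sq h2_h1 hh1x.symm hh2x.symm
    (by rw [hh1θ, neg_neg]) (by rw [hh2θ, neg_neg]) hxθ hθsq
  obtain ⟨deriv_comm, deriv_sq⟩ := hermitean_derivative_rels hh1sq hh2sq h2_h1 hh1Dx.symm
    hh2Dx.symm (by rw [hh1Dθ, neg_neg]) (by rw [hh2Dθ, neg_neg]) hDD hDθsq
  rw [← hX, ← hΘ] at coord_comm coord_sq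
  rw [← hPθ] at deriv_comm deriv_sq
  refine ⟨coord_comm, coord_sq, ?_, ?_⟩
  · rw [hPx, smul_mul_assoc, deriv_comm, smul_pow, Complex.I_sq, mul_smul_comm, mul_smul_comm,
      ← smul_add, neg_one_smul, sub_eq_add_neg]
  · rw [hPx, smul_mul_assoc, mul_smul_comm, smul_smul, Complex.I_mul_I, neg_one_smul, neg_neg,
      deriv_sq]
end
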